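/- arXiv:2205.01501 — 3 statements merged into one kernel-verified Lean document; each statement's English description precedes it below -/
import Mathlib

section
/- Let w₁, …, wₙ be strictly positive real numbers (n ≥ 1). Then the function β ↦ ESS(β) = (∑ᵢ₌₁ⁿ wᵢ^β)² / (∑ᵢ₌₁ⁿ wᵢ^{2β}) is antitone (non-increasing) on [0, ∞): for all 0 ≤ β₁ ≤ β₂, ESS(β₂) ≤ ESS(β₁). -/
/-- If `q i - p i` and `q i + p i - T` always have the same sign and `p`, `q` have equal sums,
then the sum of squares of `p` is at most that of `q`. -/
lemma Finset.sum_sq_le_sum_sq_of_sum_eq {ι : Type*} {s : Finset ι} {p q : ι → ℝ} {T : ℝ}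
    (hsum : ∑ i ∈ s, p i = ∑ i ∈ s, q i)
    (h : ∀ i ∈ s, 0 ≤ (q i - p i) * (q i + p i - T)) :
    ∑ i ∈ s, p i ^ 2 ≤ ∑ i ∈ s, q i ^ 2 := by
  have key : ∑ i ∈ s, (q i - p i) * (q i + p i - T) =
      (∑ i ∈ s, q i ^ 2 - ∑ i ∈ s, p i ^ 2) - T * (∑ i ∈ s, q i - ∑ i ∈ s, p i) := by
    simp only [← Finset.sum_sub_distrib, Finset.mul_sum]
    exact Finset.sum_congr rfl fun i _ => by ring
  have := Finset.sum_nonneg h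
  rw [key, hsum] at this
  linarith

/-- The curves `x ↦ x ^ a * B` and `x ↦ x ^ b * A` cross at a single point `t`. -/
lemma Real.exists_nonneg_sub_mul_add_sub {a b A B : ℝ} (ha : 0 ≤ a) (hab : a < b) (hA : 0 < A)
    (hB : 0 < B) :
    ∃ T : ℝ, ∀ x : ℝ, 0 < x →
      0 ≤ (x ^ b * A - x ^ a * B) * (x ^ b * A + x ^ a * B - T) := by
  have hd : 0 < b - a := sub_pos.2 hab
  set t : ℝ := (B / A) ^ (b - a)⁻¹ with ht
  have ht0 : 0 < t := by positivity
  have htd : t ^ (b - a) * A = B := by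
    rw [ht, Real.rpow_inv_rpow (by positivity) hd.ne', div_mul_cancel₀ _ hA.ne']
  refine ⟨t ^ b * A + t ^ a * B, fun x hx => ?_⟩
  have hfac : x ^ b * A - x ^ a * B = x ^ a * A * (x ^ (b - a) - t ^ (b - a)) := by
    have : x ^ b = x ^ a * x ^ (b - a) := by rw [← Real.rpow_add hx]; ring_nf
    rw [this, ← htd]; ring
  rw [hfac]
  have hb : 0 ≤ b := ha.trans hab.le
  have hpos : 0 ≤ x ^ a * A := by positivity
  rcases le_total t x with h | h
  · refine mul_nonneg (mul_nonneg hpos (sub_nonneg.2 ?_)) (sub_nonneg.2 ?_) <;> gcongr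
  · refine mul_nonneg_of_nonpos_of_nonpos
      (mul_nonpos_of_nonneg_of_nonpos hpos (sub_nonpos.2 ?_)) (sub_nonpos.2 ?_) <;> gcongr

/-- For strictly positive weights `w₁, …, wₙ` (`n ≥ 1`), the effective sample size
`ESS(β) = (∑ᵢ wᵢ^β)² / ∑ᵢ wᵢ^(2β)` is antitone (non-increasing) on `[0, ∞)`. -/
theorem ess_antitoneOn (n : ℕ) (hn : 1 ≤ n) (w : Fin n → ℝ) (hw : ∀ i, 0 < w i) :
    AntitoneOn (fun β : ℝ => (∑ i, w i ^ β) ^ 2 / ∑ i, w i ^ (2 * β)) (Set.Ici 0) := by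
  intro a ha b _ hab
  rcases hab.eq_or_lt with rfl | hab
  · exact le_rfl
  have : Nonempty (Fin n) := ⟨⟨0, hn⟩⟩
  have hS (β : ℝ) : 0 < ∑ i, w i ^ β :=
    Finset.sum_pos (fun i _ => Real.rpow_pos_of_pos (hw i) β) Finset.univ_nonempty
  have hsq (β : ℝ) (i : Fin n) : w i ^ (2 * β) = (w i ^ β) ^ 2 := by
    rw [mul_comm, Real.rpow_mul (hw i).le, Real.rpow_two]
  obtain ⟨T, hT⟩ := Real.exists_nonneg_sub_mul_add_sub ha hab (hS a) (hS b)
  have key := Finset.sum_sq_le_sum_sq_of_sum_eq (s := Finset.univ)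
    (p := fun i => w i ^ a * ∑ j, w j ^ b) (q := fun i => w i ^ b * ∑ j, w j ^ a) (T := T)
    (by rw [← Finset.sum_mul, ← Finset.sum_mul, mul_comm]) fun i _ => hT (w i) (hw i)
  simp only [mul_pow, ← Finset.sum_mul, ← hsq] at key
  change _ / _ ≤ _ / _
  rw [div_le_div_iff₀ (hS _) (hS _)]
  linarith
end

section
/- Let (X, 𝒜, μ) be a measure space and let π, q : X → ℝ be measurable functions that are strictly positive μ-almost everywhere, with ∫ π dμ = ∫ q dμ = 1. Assume x ↦ π(x) log(π(x)/q(x)) is integrable, and that C(β) = ∫ π^β q^{1−β} dμ is strictly positive for every β ∈ [0,1]. Define k : [0,1] → ℝ by k(β) = (1−β) · D + log C(β), where D = ∫ π log(π/q) dμ (so that k(β) = KL(π ‖ π_β)). Then: (i) k is convex on [0,1]; (ii) k(β) ≥ 0 for all β ∈ [0,1]; (iii) k(1) = 0 and k(0) = D; and (iv) k is antitone (non-increasing) on [0,1]. -/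
open MeasureTheory

/-- Geometric mixtures of two a.e. positive integrable functions are integrable. -/
theorem integrable_rpow_mul_rpow_one_sub {X : Type*} [MeasurableSpace X] {μ : Measure X}
    {p q : X → ℝ} (hppos : ∀ᵐ x ∂μ, 0 < p x) (hqpos : ∀ᵐ x ∂μ, 0 < q x)
    (hp : Integrable p μ) (hq : Integrable q μ) {β : ℝ} (hβ : β ∈ Set.Icc (0 : ℝ) 1) :
    Integrable (fun x => p x ^ β * q x ^ (1 - β)) μ := by
  refine Integrable.mono' ((hp.const_mul β).add (hq.const_mul (1 - β)))
    ((hp.aemeasurable.pow_const β).mul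
      (hq.aemeasurable.pow_const (1 - β))).aestronglyMeasurable ?_
  filter_upwards [hppos, hqpos] with x hpx hqx
  rw [Real.norm_of_nonneg (by positivity)]
  exact Real.geom_mean_le_arith_mean2_weighted hβ.1 (sub_nonneg.2 hβ.2) hpx.le hqx.le
    (by ring)

/-- The logarithm of the normalising constant of a geometric mixture is convex. -/
theorem convexOn_log_integral_rpow_mul_rpow_one_sub {X : Type*} [MeasurableSpace X]
    {μ : Measure X} {p q : X → ℝ} (hppos : ∀ᵐ x ∂μ, 0 < p x) (hqpos : ∀ᵐ x ∂μ, 0 < q x)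
    (hp : Integrable p μ) (hq : Integrable q μ)
    (hpos : ∀ β ∈ Set.Icc (0 : ℝ) 1, 0 < ∫ x, p x ^ β * q x ^ (1 - β) ∂μ) :
    ConvexOn ℝ (Set.Icc (0 : ℝ) 1)
      (fun β => Real.log (∫ x, p x ^ β * q x ^ (1 - β) ∂μ)) := by
  refine ⟨convex_Icc 0 1, fun s hs t ht a b ha hb hab => ?_⟩
  have hz := convex_Icc (0 : ℝ) 1 hs ht ha hb hab
  have hCs := hpos s hs
  have hCt := hpos t ht
  have hCz := hpos _ hz
  have his := integrable_rpow_mul_rpow_one_sub hppos hqpos hp hq hs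
  have hit := integrable_rpow_mul_rpow_one_sub hppos hqpos hp hq ht
  have hiz := integrable_rpow_mul_rpow_one_sub hppos hqpos hp hq hz
  simp only [smul_eq_mul] at hCz hiz ⊢
  set Cs := ∫ x, p x ^ s * q x ^ (1 - s) ∂μ with hCs_def
  set Ct := ∫ x, p x ^ t * q x ^ (1 - t) ∂μ with hCt_def
  have key : (∫ x, p x ^ (a * s + b * t) * q x ^ (1 - (a * s + b * t)) ∂μ) / (Cs ^ a * Ct ^ b)
      ≤ 1 := by
    calc _ = ∫ x, p x ^ (a * s + b * t) * q x ^ (1 - (a * s + b * t)) / (Cs ^ a * Ct ^ b) ∂μ :=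
          (integral_div _ _).symm
      _ ≤ ∫ x, (a * (p x ^ s * q x ^ (1 - s) / Cs) + b * (p x ^ t * q x ^ (1 - t) / Ct)) ∂μ := by
          refine integral_mono_ae (hiz.div_const _)
            (((his.div_const _).const_mul a).add ((hit.div_const _).const_mul b)) ?_
          filter_upwards [hppos, hqpos] with x hpx hqx
          refine le_trans (le_of_eq ?_) (Real.geom_mean_le_arith_mean2_weighted ha hb
            (p₁ := p x ^ s * q x ^ (1 - s) / Cs) (p₂ := p x ^ t * q x ^ (1 - t) / Ct)
            (by positivity) (by positivity) hab)
          have h1 : 1 - (a * s + b * t) = (1 - s) * a + (1 - t) * b := by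
            linear_combination -hab
          rw [Real.div_rpow (by positivity) hCs.le, Real.div_rpow (by positivity) hCt.le,
            Real.mul_rpow (by positivity) (by positivity),
            Real.mul_rpow (by positivity) (by positivity),
            ← Real.rpow_mul hpx.le, ← Real.rpow_mul hqx.le, ← Real.rpow_mul hpx.le,
            ← Real.rpow_mul hqx.le, h1, Real.rpow_add hpx, Real.rpow_add hqx,
            mul_comm a s, mul_comm b t]
          ring
      _ = 1 := by
          rw [integral_add ((his.div_const _).const_mul a) ((hit.div_const _).const_mul b),
            integral_const_mul, integral_const_mul, integral_div, integral_div,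
            ← hCs_def, ← hCt_def, div_self hCs.ne', div_self hCt.ne']
          linarith
  rw [div_le_one (by positivity)] at key
  calc _ ≤ Real.log (Cs ^ a * Ct ^ b) := Real.log_le_log hCz key
    _ = _ := by
      rw [Real.log_mul (by positivity) (by positivity), Real.log_rpow hCs, Real.log_rpow hCt]

/-- Jensen's inequality for the normalising constant of a geometric mixture. -/
theorem exp_neg_mul_integral_le_integral_rpow_mul_rpow {X : Type*} [MeasurableSpace X]
    {μ : Measure X} {p q : X → ℝ} (hppos : ∀ᵐ x ∂μ, 0 < p x) (hqpos : ∀ᵐ x ∂μ, 0 < q x)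
    (hp : Integrable p μ) (hq : Integrable q μ) (hp1 : ∫ x, p x ∂μ = 1)
    (hint : Integrable (fun x => p x * Real.log (p x / q x)) μ)
    {β : ℝ} (hβ : β ∈ Set.Icc (0 : ℝ) 1) :
    Real.exp (-((1 - β) * ∫ x, p x * Real.log (p x / q x) ∂μ))
      ≤ ∫ x, p x ^ β * q x ^ (1 - β) ∂μ := by
  set c := (1 - β) * ∫ x, p x * Real.log (p x / q x) ∂μ with hc
  have h1 : Integrable (fun x => (1 + c) * p x) μ := hp.const_mul _
  have h2 : Integrable (fun x => (1 - β) * (p x * Real.log (p x / q x))) μ := hint.const_mul _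
  calc Real.exp (-c)
      = ∫ x, Real.exp (-c) * ((1 + c) * p x - (1 - β) * (p x * Real.log (p x / q x))) ∂μ := by
        rw [integral_const_mul, integral_sub h1 h2, integral_const_mul, integral_const_mul,
          hp1, ← hc]
        ring
    _ ≤ _ := by
        refine integral_mono_ae ((h1.sub h2).const_mul _)
          (integrable_rpow_mul_rpow_one_sub hppos hqpos hp hq hβ) ?_
        filter_upwards [hppos, hqpos] with x hpx hqx
        have h3 : p x ^ β * q x ^ (1 - β)
            = p x * (Real.exp (-c) * Real.exp (c - (1 - β) * Real.log (p x / q x))) := by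
          rw [← Real.exp_add, Real.rpow_def_of_pos hpx, Real.rpow_def_of_pos hqx,
            Real.log_div hpx.ne' hqx.ne', ← Real.exp_add]
          nth_rw 2 [← Real.exp_log hpx]
          rw [← Real.exp_add]
          ring_nf
        have h4 := Real.add_one_le_exp (c - (1 - β) * Real.log (p x / q x))
        have h5 := mul_le_mul_of_nonneg_left h4 (mul_pos hpx (Real.exp_pos (-c))).le
        simp only [h3]
        linarith

/-- With `D = ∫ p log(p/q) dμ`, `C(β) = ∫ p^β q^(1−β) dμ > 0` on `[0,1]`, and
`k(β) = (1−β)·D + log C(β)` (i.e. `k(β) = KL(p ‖ p_β)`), the function `k` is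
(i) convex on `[0,1]`, (ii) nonnegative on `[0,1]`, (iii) satisfies `k(1) = 0` and
`k(0) = D`, and (iv) is antitone on `[0,1]`. -/
theorem kl_tempered_convex_antitone
    {X : Type*} [MeasurableSpace X] (μ : Measure X) (p q : X → ℝ)
    (hpm : Measurable p) (hqm : Measurable q)
    (hppos : ∀ᵐ x ∂μ, 0 < p x) (hqpos : ∀ᵐ x ∂μ, 0 < q x)
    (hp1 : ∫ x, p x ∂μ = 1) (hq1 : ∫ x, q x ∂μ = 1)
    (hint : Integrable (fun x => p x * Real.log (p x / q x)) μ)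
    (C : ℝ → ℝ) (hC : ∀ β, C β = ∫ x, p x ^ β * q x ^ (1 - β) ∂μ)
    (hCpos : ∀ β ∈ Set.Icc (0 : ℝ) 1, 0 < C β)
    (D : ℝ) (hD : D = ∫ x, p x * Real.log (p x / q x) ∂μ)
    (k : ℝ → ℝ) (hk : ∀ β, k β = (1 - β) * D + Real.log (C β)) :
    ConvexOn ℝ (Set.Icc (0 : ℝ) 1) k ∧
    (∀ β ∈ Set.Icc (0 : ℝ) 1, 0 ≤ k β) ∧
    k 1 = 0 ∧ k 0 = D ∧
    AntitoneOn k (Set.Icc (0 : ℝ) 1) := by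
  have hp : Integrable p μ := by
    by_contra h
    simp [integral_undef h] at hp1
  have hq : Integrable q μ := by
    by_contra h
    simp [integral_undef h] at hq1
  obtain rfl : C = fun β => ∫ x, p x ^ β * q x ^ (1 - β) ∂μ := funext hC
  obtain rfl : k = fun β => (1 - β) * D +
      Real.log (∫ x, p x ^ β * q x ^ (1 - β) ∂μ) := funext hk
  have hconv : ConvexOn ℝ (Set.Icc (0 : ℝ) 1) (fun β => (1 - β) * D +
      Real.log (∫ x, p x ^ β * q x ^ (1 - β) ∂μ)) := by
    refine ConvexOn.add ⟨convex_Icc 0 1, fun s _ t _ a b _ _ hab => le_of_eq ?_⟩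
      (convexOn_log_integral_rpow_mul_rpow_one_sub hppos hqpos hp hq hCpos)
    simp only [smul_eq_mul]
    linear_combination -D * hab
  have hnonneg : ∀ β ∈ Set.Icc (0 : ℝ) 1, 0 ≤ (1 - β) * D +
      Real.log (∫ x, p x ^ β * q x ^ (1 - β) ∂μ) := fun β hβ => by
    have h := (Real.le_log_iff_exp_le (hCpos β hβ)).2
      (exp_neg_mul_integral_le_integral_rpow_mul_rpow hppos hqpos hp hq hp1 hint hβ)
    rw [← hD] at h
    linarith
  refine ⟨hconv, hnonneg, by simp [hp1], by simp [hq1], fun s hs t ht hst => ?_⟩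
  have h := hconv.le_max_of_mem_Icc hs (Set.right_mem_Icc.2 zero_le_one) ⟨hst, ht.2⟩
  refine h.trans (max_le le_rfl ?_)
  simpa [hp1] using hnonneg s hs
end

section
/- Let (X, 𝒜, μ) be a measure space and let π, q : X → ℝ be measurable functions that are strictly positive μ-a.e., with ∫ π dμ = ∫ q dμ = 1. Fix β ∈ (0,1) and s ∈ (0, 1], and set E = {x : π(x)^β ≤ s · q(x)^β} with complement Ē. Let C = ∫ π^β q^{1−β} dμ and define the normalized tempered density π_β = π^β q^{1−β} / C; let h = s·q·1_E + π^β q^{1−β}·1_Ē, Z = ∫ h dμ, and define the normalized anti-truncated density π̂_β = h / Z. Assume 0 < ∫_E π^β q^{1−β} dμ, 0 < ∫_Ē π^β q^{1−β} dμ, 0 < ∫_E q dμ < 1, and that π_β·log(π_β/q) is integrable. Then 0 ≤ KL(π_β ‖ π̂_β) ≤ KL(π_β ‖ q), where KL(u‖v) = ∫ u log(u/v) dμ. -/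
open MeasureTheory

/-- If `g ≤ s q` on `E` and `s q ≤ g` off `E`, the normalization `g / C` is at least as close in KL divergence
to the normalization of `s q 1_E + g 1_Eᶜ` as to the probability density `q`. -/
theorem kl_truncation_between
    {X : Type*} [MeasurableSpace X] {μ : Measure X} {g q h : X → ℝ} {E : Set X} {s C Z : ℝ}
    (hEm : MeasurableSet E) (hs : 0 < s) (hg : Integrable g μ) (hq : Integrable q μ)
    (hgpos : ∀ᵐ x ∂μ, 0 < g x) (hqpos : ∀ᵐ x ∂μ, 0 < q x)
    (hq1 : ∫ x, q x ∂μ = 1)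
    (hgE : ∀ᵐ x ∂μ, x ∈ E → g x ≤ s * q x) (hgEc : ∀ᵐ x ∂μ, x ∉ E → s * q x ≤ g x)
    (hhE : ∀ x ∈ E, h x = s * q x) (hhEc : ∀ x ∉ E, h x = g x)
    (hC : C = ∫ x, g x ∂μ) (hCpos : 0 < C) (hZ : Z = ∫ x, h x ∂μ)
    (hEcmass : 0 < ∫ x in Eᶜ, g x ∂μ)
    (hint : Integrable (fun x => g x / C * Real.log (g x / C / q x)) μ) :
    0 ≤ ∫ x, g x / C * Real.log (g x / C / (h x / Z)) ∂μ ∧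
      ∫ x, g x / C * Real.log (g x / C / (h x / Z)) ∂μ ≤
        ∫ x, g x / C * Real.log (g x / C / q x) ∂μ := by
  have hh_eq : h = fun x => E.indicator (fun y => s * q y) x + Eᶜ.indicator g x := by
    ext x
    by_cases hx : x ∈ E <;> simp [hx, hhE, hhEc]
  have hi₁ : Integrable (E.indicator (fun y => s * q y)) μ := (hq.const_mul s).indicator hEm
  have hi₂ : Integrable (Eᶜ.indicator g) μ := hg.indicator hEm.compl
  have hhint : Integrable h μ := hh_eq ▸ hi₁.add hi₂
  have hZ_eq : Z = s * ∫ x in E, q x ∂μ + ∫ x in Eᶜ, g x ∂μ := by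
    rw [hZ, hh_eq, integral_add hi₁ hi₂, integral_indicator hEm, integral_indicator hEm.compl,
      integral_const_mul]
  have hC_eq : (∫ x in E, g x ∂μ) + ∫ x in Eᶜ, g x ∂μ = C := hC ▸ integral_add_compl hEm hg
  have hq_eq : (∫ x in E, q x ∂μ) + ∫ x in Eᶜ, q x ∂μ = 1 := hq1 ▸ integral_add_compl hEm hq
  have hA : ∫ x in E, g x ∂μ ≤ s * ∫ x in E, q x ∂μ := by
    rw [← integral_const_mul]
    exact setIntegral_mono_on_ae hg.integrableOn (hq.const_mul s).integrableOn hEm hgE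
  have hB : s * ∫ x in Eᶜ, q x ∂μ ≤ ∫ x in Eᶜ, g x ∂μ := by
    rw [← integral_const_mul]
    exact setIntegral_mono_on_ae (hq.const_mul s).integrableOn hg.integrableOn hEm.compl hgEc
  have hQ : 0 ≤ ∫ x in E, q x ∂μ :=
    integral_nonneg_of_ae (ae_restrict_of_ae (hqpos.mono fun x hx => hx.le))
  have hZpos : 0 < Z := by rw [hZ_eq]; positivity
  have hgC : Integrable (fun x => g x / C) μ := hg.div_const C
  have hFint : Integrable (fun x => g x / C * Real.log (g x / C / (h x / Z))) μ := by
    have hF : Integrable (fun x =>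
        E.indicator (fun y => g y / C * Real.log (g y / C / q y) -
          g y / C * Real.log (s / Z)) x +
        Eᶜ.indicator (fun y => g y / C * Real.log (Z / C)) x) μ :=
      ((hint.sub (hgC.mul_const _)).indicator hEm).add ((hgC.mul_const _).indicator hEm.compl)
    refine hF.congr ?_
    filter_upwards [hgpos, hqpos] with x hgx hqx
    by_cases hx : x ∈ E
    · simp only [hx, Set.indicator_of_mem, Set.mem_compl_iff, not_true_eq_false,
        not_false_eq_true, Set.indicator_of_notMem, add_zero, hhE x hx]
      rw [← mul_sub, ← Real.log_div (by positivity) (by positivity)]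
      congr 2
      field_simp
    · simp only [hx, Set.indicator_of_mem, Set.mem_compl_iff, not_false_eq_true,
        Set.indicator_of_notMem, zero_add, hhEc x hx]
      congr 2
      field_simp
  have hhpos : ∀ᵐ x ∂μ, 0 < h x := by
    filter_upwards [hgpos, hqpos] with x hgx hqx
    by_cases hx : x ∈ E
    · rw [hhE x hx]; positivity
    · rwa [hhEc x hx]
  constructor
  · calc (0 : ℝ) = ∫ x, (g x / C - h x / Z) ∂μ := by
          rw [integral_sub hgC (hhint.div_const Z), integral_div, integral_div, ← hC, ← hZ,
            div_self hCpos.ne', div_self hZpos.ne', sub_self]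
      _ ≤ _ := by
          refine integral_mono_ae (hgC.sub (hhint.div_const Z)) hFint ?_
          filter_upwards [hgpos, hhpos] with x hgx hhx
          have hu : 0 < g x / C := by positivity
          have hv : 0 < h x / Z := by positivity
          calc g x / C - h x / Z = g x / C * (1 - (g x / C / (h x / Z))⁻¹) := by field_simp
            _ ≤ _ := by gcongr; exact Real.one_sub_inv_le_log_of_pos (by positivity)
  · rw [← sub_nonneg, ← integral_sub hint hFint]
    have hk₁ : Integrable (E.indicator (fun y => g y / s)) μ := (hg.div_const s).indicator hEm
    have hk₂ : Integrable (Eᶜ.indicator q) μ := hq.indicator hEm.compl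
    have hk : Integrable (fun x =>
        Z / C * (E.indicator (fun y => g y / s) x + Eᶜ.indicator q x)) μ :=
      (hk₁.add hk₂).const_mul _
    calc (0 : ℝ) ≤ 1 - Z / C * ((∫ x in E, g x ∂μ) / s + ∫ x in Eᶜ, q x ∂μ) := by
          rw [sub_nonneg, div_mul_eq_mul_div, div_le_one hCpos, hZ_eq, ← hC_eq]
          set a := ∫ x in E, g x ∂μ
          set b := ∫ x in Eᶜ, g x ∂μ
          set c := ∫ x in E, q x ∂μ
          set d := ∫ x in Eᶜ, q x ∂μ
          have hd : d = 1 - c := by linarith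
          have : a + b - (s * c + b) * (a / s + d) = (b - s * d) * (s * c - a) / s := by
            rw [hd]; field_simp; ring
          have : 0 ≤ (b - s * d) * (s * c - a) / s :=
            div_nonneg (mul_nonneg (by linarith) (by linarith)) hs.le
          linarith
      _ = ∫ x, (g x / C - Z / C * (E.indicator (fun y => g y / s) x + Eᶜ.indicator q x)) ∂μ := by
          rw [integral_sub hgC hk, integral_const_mul, integral_add hk₁ hk₂,
            integral_indicator hEm, integral_indicator hEm.compl, integral_div, integral_div,
            ← hC, div_self hCpos.ne']
      _ ≤ _ := by
          refine integral_mono_ae (hgC.sub hk) (hint.sub hFint) ?_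
          filter_upwards [hgpos, hqpos, hhpos] with x hgx hqx hhx
          have hlog : Real.log (g x / C / q x) - Real.log (g x / C / (h x / Z)) =
              Real.log (h x / (Z * q x)) := by
            rw [← Real.log_div (by positivity) (by positivity)]
            congr 1
            field_simp
          calc _ = g x / C * (1 - (h x / (Z * q x))⁻¹) := by
                by_cases hx : x ∈ E
                · simp [hx, hhE x hx]
                  field_simp
                · simp [hx, hhEc x hx]
                  field_simp
            _ ≤ g x / C * Real.log (h x / (Z * q x)) := by
                gcongr; exact Real.one_sub_inv_le_log_of_pos (by positivity)
            _ = _ := by rw [← hlog, mul_sub]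

/-- Main proposition: the tempered density `p_β = p^β q^(1−β)/C` is closer (in KL
divergence) to the normalized anti-truncated density `p̂_β = h/Z` (where
`h = s·q·1_E + p^β q^(1−β)·1_Ē` and `E = {x : p(x)^β ≤ s·q(x)^β}`, `s ∈ (0,1]`) than to
the proposal `q`: `0 ≤ KL(p_β ‖ p̂_β) ≤ KL(p_β ‖ q)`. -/
theorem kl_tempered_anti_truncated_between
    {X : Type*} [MeasurableSpace X] (μ : Measure X) (p q : X → ℝ)
    (hpm : Measurable p) (hqm : Measurable q)
    (hppos : ∀ᵐ x ∂μ, 0 < p x) (hqpos : ∀ᵐ x ∂μ, 0 < q x)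
    (hp1 : ∫ x, p x ∂μ = 1) (hq1 : ∫ x, q x ∂μ = 1)
    (β : ℝ) (hβ : β ∈ Set.Ioo (0 : ℝ) 1) (s : ℝ) (hs : s ∈ Set.Ioc (0 : ℝ) 1)
    (E : Set X) (hE : E = {x | p x ^ β ≤ s * q x ^ β})
    (C : ℝ) (hC : C = ∫ x, p x ^ β * q x ^ (1 - β) ∂μ)
    (pB : X → ℝ) (hpB : pB = fun x => p x ^ β * q x ^ (1 - β) / C)
    (h : X → ℝ)
    (hh : h = fun x => E.indicator (fun y => s * q y) x +
      Eᶜ.indicator (fun y => p y ^ β * q y ^ (1 - β)) x)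
    (Z : ℝ) (hZ : Z = ∫ x, h x ∂μ)
    (pHat : X → ℝ) (hpHat : pHat = fun x => h x / Z)
    (hEmass : 0 < ∫ x in E, p x ^ β * q x ^ (1 - β) ∂μ)
    (hEcmass : 0 < ∫ x in Eᶜ, p x ^ β * q x ^ (1 - β) ∂μ)
    (hqE : 0 < ∫ x in E, q x ∂μ) (hqE' : (∫ x in E, q x ∂μ) < 1)
    (hint : Integrable (fun x => pB x * Real.log (pB x / q x)) μ) :
    0 ≤ ∫ x, pB x * Real.log (pB x / pHat x) ∂μ ∧
      ∫ x, pB x * Real.log (pB x / pHat x) ∂μ ≤ ∫ x, pB x * Real.log (pB x / q x) ∂μ := by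
  have hEm : MeasurableSet E :=
    hE ▸ measurableSet_le (hpm.pow_const β) ((hqm.pow_const β).const_mul s)
  have hg : Integrable (fun x => p x ^ β * q x ^ (1 - β)) μ := by
    rw [← integrableOn_univ, ← Set.union_compl_self E]
    exact IntegrableOn.union (.of_integral_ne_zero hEmass.ne')
      (.of_integral_ne_zero hEcmass.ne')
  have hsplit : ∀ᵐ x ∂μ, s * q x = s * q x ^ β * q x ^ (1 - β) := by
    filter_upwards [hqpos] with x hqx
    rw [mul_assoc, ← Real.rpow_add hqx, add_sub_cancel, Real.rpow_one]
  have hCpos : 0 < C := by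
    rw [hC, ← integral_add_compl hEm hg]
    exact add_pos hEmass hEcmass
  subst hpB hpHat
  refine kl_truncation_between hEm hs.1 hg (.of_integral_ne_zero (by simp [hq1])) ?_ hqpos hq1
    ?_ ?_ ?_ ?_ hC hCpos hZ hEcmass hint
  · filter_upwards [hppos, hqpos] with x hpx hqx
    positivity
  · filter_upwards [hqpos, hsplit] with x hqx hx hxE
    rw [hx]
    have : p x ^ β ≤ s * q x ^ β := by simpa [hE] using hxE
    gcongr
  · filter_upwards [hqpos, hsplit] with x hqx hx hxE
    rw [hx]
    have : s * q x ^ β < p x ^ β := by simpa [hE] using hxE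
    gcongr
  · intro x hx
    simp [hh, hx]
  · intro x hx
    simp [hh, hx]
end
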